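/- arXiv:2501.14222 — 2 statements merged into one kernel-verified Lean document; each statement's English description precedes it below -/
import Mathlib

section
/- Let $r\ge k\ge 1$ be integers, let $L=(l^{(a)}_i)$ be a $k\times r$ real matrix of rank $k$, and fix a linear isomorphism $\Phi:\mathbb{R}^{r-k}\times\mathbb{R}^{k}\to\mathbb{R}^{r}$ with $|\det\Phi|=1$ and $L(\Phi(w,v))=v$ for all $(w,v)$. Fix a real $z>0$, angles $\theta_1,\dots,\theta_r\in(-\pi/2,\pi/2)$, and $\gamma\in\mathbb{R}^k$ with $(L^{T}\gamma)_i>0$ for every $i=1,\dots,r$. Define $g(v)=\int_{\mathbb{R}^{r-k}}\exp\big(-\tfrac{1}{z}\sum_{i=1}^{r}e^{\Phi(w,v)_i+\sqrt{-1}\theta_i}\big)\,dw$ for $v\in\mathbb{R}^k$. Then for every $v\in\mathbb{R}^k$ the integral $(2\pi)^{-k}\int_{\mathbb{R}^k}\Big[\prod_{i=1}^{r}z^{a_i(y)}\,e^{-\sqrt{-1}\,\theta_i\,a_i(y)}\,\Gamma(a_i(y))\Big]\,e^{-\langle\gamma+\sqrt{-1}y,\;v\rangle}\,dy$, where $a_i(y)=(L^{T}(\gamma+\sqrt{-1}y))_i$,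 converges absolutely and equals $g(v)$. -/
open Real MeasureTheory

theorem exists_exp_sub_exp_le {α b : ℝ} (hα : 0 < α) (hb : 0 < b) :
    ∃ C : ℝ, ∀ x : ℝ, rexp (α * x - b * rexp x) ≤ C * rexp (-(α * |x|)) := by
  refine ⟨rexp (2 * α ^ 2 / b), fun x => ?_⟩
  rw [← Real.exp_add, Real.exp_le_exp]
  have hC : 0 ≤ 2 * α ^ 2 / b := by positivity
  rcases le_total x 0 with hx | hx
  · rw [abs_of_nonpos hx]
    nlinarith [mul_pos hb (Real.exp_pos x)]
  · rw [abs_of_nonneg hx]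
    have h1 : x ^ 2 / 2 ≤ rexp x := by
      have := Real.quadratic_le_exp_of_nonneg hx
      linarith
    have h2 : 2 * α * x - b * (x ^ 2 / 2) ≤ 2 * α ^ 2 / b := by
      rw [le_div_iff₀ hb]
      nlinarith [sq_nonneg (b * x - 2 * α)]
    nlinarith [mul_le_mul_of_nonneg_left h1 hb.le]

theorem integrable_exp_neg_mul_abs {c : ℝ} (hc : 0 < c) :
    Integrable fun x : ℝ => rexp (-(c * |x|)) := by
  rw [← integrableOn_univ, ← Set.Iic_union_Ioi (a := (0 : ℝ)), integrableOn_union]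
  constructor
  · refine (integrableOn_exp_mul_Iic hc 0).congr_fun (fun x hx => ?_) measurableSet_Iic
    simp [abs_of_nonpos (Set.mem_Iic.mp hx)]
  · refine (integrableOn_exp_mul_Ioi (neg_lt_zero.mpr hc) 0).congr_fun (fun x hx => ?_)
      measurableSet_Ioi
    simp [abs_of_pos (Set.mem_Ioi.mp hx)]

theorem integrable_exp_sub_exp {α b : ℝ} (hα : 0 < α) (hb : 0 < b) :
    Integrable fun x : ℝ => rexp (α * x - b * rexp x) := by
  obtain ⟨C, hC⟩ := exists_exp_sub_exp_le hα hb
  refine ((integrable_exp_neg_mul_abs hα).const_mul C).mono' (by fun_prop)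
    (.of_forall fun x => ?_)
  rw [Real.norm_of_nonneg (Real.exp_pos _).le]
  exact hC x

/-- The integrand of the Mellin transform of `t ↦ exp (-p e^{iτ} t)` in the coordinate
`x = log t`. -/
noncomputable def rotatedKernel (p τ : ℝ) (s : ℂ) (x : ℝ) : ℂ :=
  Complex.exp (s * x - p * Complex.exp (x + Complex.I * τ))

theorem norm_rotatedKernel (p τ : ℝ) (s : ℂ) (x : ℝ) :
    ‖rotatedKernel p τ s x‖ = rexp (s.re * x - p * cos τ * rexp x) := by
  rw [rotatedKernel, Complex.norm_exp]
  congr 1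
  simp [Complex.exp_re]
  ring

@[fun_prop]
theorem continuous_rotatedKernel (p τ : ℝ) (s : ℂ) : Continuous (rotatedKernel p τ s) := by
  unfold rotatedKernel
  fun_prop

theorem integrable_rotatedKernel {p τ : ℝ} {s : ℂ} (hp : 0 < p)
    (hτ : τ ∈ Set.Ioo (-(π / 2)) (π / 2)) (hs : 0 < s.re) :
    Integrable (rotatedKernel p τ s) := by
  refine (integrable_exp_sub_exp hs (mul_pos hp (cos_pos_of_mem_Ioo hτ))).mono'
    (by fun_prop) (.of_forall fun x => ?_)
  rw [norm_rotatedKernel]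

theorem rotatedKernel_add_one (p τ : ℝ) (s : ℂ) (x : ℝ) :
    rotatedKernel p τ (s + 1) x = Complex.exp x * rotatedKernel p τ s x := by
  simp only [rotatedKernel]
  rw [← Complex.exp_add]
  congr 1
  ring

theorem integral_rotatedKernel_add_one {p τ : ℝ} {s : ℂ} (hp : 0 < p)
    (hτ : τ ∈ Set.Ioo (-(π / 2)) (π / 2)) (hs : 0 < s.re) :
    p * Complex.exp (Complex.I * τ) * ∫ x, rotatedKernel p τ (s + 1) x =
      s * ∫ x, rotatedKernel p τ s x := by
  have h0 := integrable_rotatedKernel hp hτ hs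
  have h1 : Integrable (rotatedKernel p τ (s + 1)) :=
    integrable_rotatedKernel hp hτ (by simp; linarith)
  have hd : ∀ x : ℝ, HasDerivAt (rotatedKernel p τ s)
      (s * rotatedKernel p τ s x
        - p * Complex.exp (Complex.I * τ) * rotatedKernel p τ (s + 1) x) x := by
    intro x
    have hx : HasDerivAt (fun x : ℝ => (x : ℂ)) 1 x := Complex.ofRealCLM.hasDerivAt
    have := ((hx.const_mul s).sub
      (((hx.add_const (Complex.I * τ)).cexp).const_mul (p : ℂ))).cexp
    refine this.congr_deriv ?_
    rw [rotatedKernel_add_one, rotatedKernel, Pi.sub_apply, Complex.exp_add]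
    ring
  have hi := integral_eq_zero_of_hasDerivAt_of_integrable hd
    ((h0.const_mul s).sub (h1.const_mul _)) h0
  rw [integral_sub (h0.const_mul s) (h1.const_mul _), integral_const_mul,
    integral_const_mul] at hi
  exact (sub_eq_zero.mp hi).symm

theorem hasDerivAt_integral_rotatedKernel {p τ : ℝ} {s : ℂ} (hp : 0 < p)
    (hτ : τ ∈ Set.Ioo (-(π / 2)) (π / 2)) (hs : 0 < s.re) :
    HasDerivAt (fun τ : ℝ => ∫ x, rotatedKernel p τ s x)
      (-(Complex.I * s) * ∫ x, rotatedKernel p τ s x) τ := by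
  have hcos := cos_pos_of_mem_Ioo hτ
  have hs1 : 0 < (s + 1).re := by simp; linarith
  have hnhds : {t : ℝ | cos τ / 2 < cos t} ∈ nhds τ :=
    (isOpen_lt continuous_const continuous_cos).mem_nhds (by simp; linarith)
  have key := (hasDerivAt_integral_of_dominated_loc_of_deriv_le (μ := volume)
    (F := fun t x => rotatedKernel p t s x)
    (F' := fun t x => -(Complex.I * (p * Complex.exp (Complex.I * t))) *
      rotatedKernel p t (s + 1) x)
    (bound := fun x => p * rexp ((s + 1).re * x - p * (cos τ / 2) * rexp x))
    hnhds (.of_forall fun t => (continuous_rotatedKernel p t s).aestronglyMeasurable)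
    (integrable_rotatedKernel hp hτ hs)
    (by fun_prop)
    (.of_forall fun x t ht => ?_)
    ((integrable_exp_sub_exp hs1 (by positivity)).const_mul p)
    (.of_forall fun x t _ => ?_)).2
  · refine key.congr_deriv ?_
    rw [integral_const_mul, neg_mul, mul_assoc, integral_rotatedKernel_add_one hp hτ hs]
    ring
  · rw [norm_mul, norm_rotatedKernel, norm_neg, norm_mul, norm_mul, Complex.norm_I, one_mul,
      mul_comm Complex.I, Complex.norm_exp_ofReal_mul_I, mul_one, Complex.norm_real,
      Real.norm_of_nonneg hp.le]
    have : cos τ / 2 ≤ cos t := (show _ < _ from ht).le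
    gcongr
  · have ht : HasDerivAt (fun t : ℝ => (t : ℂ)) 1 t := Complex.ofRealCLM.hasDerivAt
    have := (((((ht.const_mul Complex.I).const_add (x : ℂ)).cexp).const_mul
      (p : ℂ)).const_sub (s * x)).cexp
    refine this.congr_deriv ?_
    rw [rotatedKernel_add_one, rotatedKernel, Complex.exp_add]
    ring

theorem integral_rotatedKernel_zero {p : ℝ} {s : ℂ} (hp : 0 < p) (hs : 0 < s.re) :
    ∫ x, rotatedKernel p 0 s x = (1 / (p : ℂ)) ^ s * Complex.Gamma s := by
  rw [← Complex.integral_cpow_mul_exp_neg_mul_Ioi hs hp, ← Real.range_exp, ← Set.image_univ,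
    integral_image_eq_integral_abs_deriv_smul MeasurableSet.univ
      (fun x _ => (Real.hasDerivAt_exp x).hasDerivWithinAt) Real.exp_injective.injOn]
  rw [setIntegral_univ]
  congr 1
  ext x
  have hx : (rexp x : ℂ) ≠ 0 := by exact_mod_cast (Real.exp_pos x).ne'
  rw [abs_of_pos (Real.exp_pos x), Complex.cpow_def_of_ne_zero hx,
    ← Complex.ofReal_log (Real.exp_pos x).le, Real.log_exp, rotatedKernel, Complex.real_smul,
    Complex.ofReal_exp, ← Complex.exp_add, ← Complex.exp_add]
  congr 1
  simp
  ring

/-- The Mellin transform of `t ↦ exp (-p e^{iτ} t)`, for `p > 0` and `|τ| < π / 2`. -/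
theorem integral_rotatedKernel {p τ : ℝ} {s : ℂ} (hp : 0 < p)
    (hτ : τ ∈ Set.Ioo (-(π / 2)) (π / 2)) (hs : 0 < s.re) :
    ∫ x, rotatedKernel p τ s x =
      (1 / (p : ℂ)) ^ s * Complex.exp (-(Complex.I * τ * s)) * Complex.Gamma s := by
  have hd : ∀ t ∈ Set.Ioo (-(π / 2)) (π / 2), HasDerivAt
      (fun t : ℝ => Complex.exp (Complex.I * t * s) * ∫ x, rotatedKernel p t s x) 0 t := by
    intro t ht
    have ht' : HasDerivAt (fun t : ℝ => (t : ℂ)) 1 t := Complex.ofRealCLM.hasDerivAt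
    refine ((((ht'.const_mul Complex.I).mul_const s).cexp).mul
      (hasDerivAt_integral_rotatedKernel hp ht hs)).congr_deriv ?_
    ring
  have h0 : (0 : ℝ) ∈ Set.Ioo (-(π / 2)) (π / 2) := by constructor <;> linarith [pi_pos]
  have hconst := isOpen_Ioo.is_const_of_deriv_eq_zero isPreconnected_Ioo
    (fun t ht => (hd t ht).differentiableAt.differentiableWithinAt)
    (fun t ht => (hd t ht).deriv) hτ h0
  simp only [Complex.ofReal_zero, mul_zero, zero_mul, Complex.exp_zero, one_mul,
    integral_rotatedKernel_zero hp hs] at hconst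
  rw [mul_right_comm, ← hconst, mul_right_comm, ← Complex.exp_add]
  simp

/-- On a vertical line in the right half-plane, `Γ` decays like `exp (-φ |Im s|)` for every
`φ < π / 2`. -/
theorem exists_norm_Gamma_le {σ φ : ℝ} (hσ : 0 < σ) (hφ : φ ∈ Set.Ioo (-(π / 2)) (π / 2)) :
    ∃ C : ℝ, ∀ s : ℂ, s.re = σ → ‖Complex.Gamma s‖ ≤ C * rexp (-(φ * |s.im|)) := by
  refine ⟨∫ x, rexp (σ * x - cos φ * rexp x), fun s hs => ?_⟩
  have key : ∀ ψ ∈ Set.Ioo (-(π / 2)) (π / 2), cos ψ = cos φ →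
      ‖Complex.Gamma s‖ ≤ (∫ x, rexp (σ * x - cos φ * rexp x)) * rexp (-(ψ * s.im)) := by
    intro ψ hψ hcos
    have h := norm_integral_le_integral_norm (μ := volume) (rotatedKernel 1 ψ s)
    simp only [norm_rotatedKernel, integral_rotatedKernel one_pos hψ (hs ▸ hσ), hs, hcos,
      one_mul] at h
    rw [norm_mul, norm_mul, Complex.norm_exp] at h
    have h2 : (-(Complex.I * ψ * s)).re = ψ * s.im := by simp
    simp only [h2, Complex.ofReal_one, div_one, Complex.one_cpow, norm_one, one_mul] at h
    rwa [Real.exp_neg, ← div_eq_mul_inv, le_div_iff₀ (Real.exp_pos _), mul_comm]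
  rcases abs_cases s.im with ⟨h, _⟩ | ⟨h, _⟩
  · rw [h]; exact key φ hφ rfl
  · rw [h, mul_neg, ← neg_mul]
    exact key (-φ) ⟨by linarith [hφ.2], by linarith [hφ.1]⟩ (cos_neg φ)

theorem exists_norm_exp_mul_Gamma_le {σ θ : ℝ} (l : ℝ) (hσ : 0 < σ)
    (hθ : θ ∈ Set.Ioo (-(π / 2)) (π / 2)) :
    ∃ C δ : ℝ, 0 < δ ∧ ∀ s : ℂ, s.re = σ →
      ‖Complex.exp (s * l) * Complex.exp (-(Complex.I * θ * s)) * Complex.Gamma s‖ ≤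
        C * rexp (-(δ * |s.im|)) := by
  have hθ' : |θ| < π / 2 := abs_lt.mpr hθ
  obtain ⟨C, hC⟩ := exists_norm_Gamma_le hσ (φ := (|θ| + π / 2) / 2)
    ⟨by linarith [abs_nonneg θ], by linarith⟩
  refine ⟨rexp (σ * l) * C, (π / 2 - |θ|) / 2, by linarith, fun s hs => ?_⟩
  have h1 : ‖Complex.exp (s * l)‖ = rexp (σ * l) := by simp [Complex.norm_exp, hs]
  have h2 : ‖Complex.exp (-(Complex.I * θ * s))‖ ≤ rexp (|θ| * |s.im|) := by
    rw [Complex.norm_exp, Real.exp_le_exp, ← abs_mul]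
    refine le_trans (le_of_eq ?_) (le_abs_self (θ * s.im))
    simp
  rw [norm_mul, norm_mul, h1]
  calc rexp (σ * l) * ‖Complex.exp (-(Complex.I * θ * s))‖ * ‖Complex.Gamma s‖
      ≤ rexp (σ * l) * rexp (|θ| * |s.im|) *
          (C * rexp (-((|θ| + π / 2) / 2 * |s.im|))) := by
        gcongr
        exact hC s hs
    _ = rexp (σ * l) * C * (rexp (|θ| * |s.im|) * rexp (-((|θ| + π / 2) / 2 * |s.im|))) := by
        ring
    _ = rexp (σ * l) * C * rexp (-((π / 2 - |θ|) / 2 * |s.im|)) := by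
        rw [← Real.exp_add]
        ring_nf

theorem exists_prod_exp_neg_abs_le {ι E : Type*} [Fintype ι] [NormedAddCommGroup E]
    [NormedSpace ℝ E] [FiniteDimensional ℝ E] {T : E →ₗ[ℝ] (ι → ℝ)}
    (hT : Function.Injective T) {α : ι → ℝ} (hα : ∀ i, 0 < α i) :
    ∃ c : ℝ, 0 < c ∧ ∀ y, ∏ i, rexp (-(α i * |T y i|)) ≤ rexp (-(c * ‖y‖)) := by
  obtain ⟨δ, hδ, hδα⟩ : ∃ δ : ℝ, 0 < δ ∧ ∀ i, δ ≤ α i := by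
    cases isEmpty_or_nonempty ι
    · exact ⟨1, one_pos, fun i => isEmptyElim i⟩
    · obtain ⟨i, hi⟩ := Finite.exists_min α
      exact ⟨α i, hα i, hi⟩
  obtain ⟨K, hK, hTK⟩ := T.injective_iff_antilipschitz.mp hT
  have hK' : (0 : ℝ) < K := by exact_mod_cast hK
  refine ⟨δ / K, by positivity, fun y => ?_⟩
  rw [← Real.exp_sum, Real.exp_le_exp, Finset.sum_neg_distrib, neg_le_neg_iff]
  have h1 : ‖y‖ ≤ K * ‖T y‖ := ZeroHomClass.bound_of_antilipschitz T hTK y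
  have h2 : ‖T y‖ ≤ ∑ i, |T y i| := by
    refine (pi_norm_le_iff_of_nonneg (Finset.sum_nonneg fun _ _ => abs_nonneg _)).mpr
      fun i => ?_
    exact Finset.single_le_sum (f := fun i => |T y i|) (fun _ _ => abs_nonneg _)
      (Finset.mem_univ i)
  calc δ / K * ‖y‖ ≤ δ / K * (K * ‖T y‖) := by gcongr
    _ = δ * ‖T y‖ := by field_simp
    _ ≤ δ * ∑ i, |T y i| := by gcongr
    _ = ∑ i, δ * |T y i| := Finset.mul_sum _ _ _
    _ ≤ ∑ i, α i * |T y i| := by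
        gcongr with i
        exact hδα i

theorem integrable_exp_neg_mul_norm {ι : Type*} [Fintype ι] {c : ℝ} (hc : 0 < c) :
    Integrable fun x : ι → ℝ => rexp (-(c * ‖x‖)) := by
  have hpos : 0 < c / (Fintype.card ι + 1) := by positivity
  refine (Integrable.fintype_prod (𝕜 := ℝ) (fun _ : ι => integrable_exp_neg_mul_abs hpos)).mono'
    (by fun_prop) (.of_forall fun x => ?_)
  rw [Real.norm_of_nonneg (Real.exp_pos _).le, ← Real.exp_sum, Real.exp_le_exp,
    Finset.sum_neg_distrib, neg_le_neg_iff, ← Finset.mul_sum]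
  have h : ∑ i, |x i| ≤ Fintype.card ι * ‖x‖ := by
    refine (Finset.sum_le_card_nsmul _ _ ‖x‖ fun i _ => norm_le_pi_norm x i).trans ?_
    simp [nsmul_eq_mul]
  calc c / (Fintype.card ι + 1) * ∑ i, |x i|
      ≤ c / (Fintype.card ι + 1) * ((Fintype.card ι + 1) * ‖x‖) := by
        gcongr
        linarith [norm_nonneg x]
    _ = c * ‖x‖ := by field_simp

/-- Fourier inversion on `ι → ℝ`, with angular frequencies. -/
theorem fourier_inversion_pi {ι : Type*} [Fintype ι] {f H : (ι → ℝ) → ℂ} (hfc : Continuous f)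
    (hf : Integrable f) (hH : Integrable H)
    (h : ∀ y, H y = ∫ v, Complex.exp (Complex.I * ∑ b, (y b : ℂ) * v b) * f v) (v : ι → ℝ) :
    (((2 * π : ℝ) : ℂ) ^ Fintype.card ι)⁻¹ *
      ∫ y, H y * Complex.exp (-(Complex.I * ∑ b, (y b : ℂ) * v b)) = f v := by
  let e := (MeasurableEquiv.toLp 2 (ι → ℝ)).symm
  have hmp : MeasurePreserving e := PiLp.volume_preserving_ofLp ι
  have hF : FourierTransform.fourier (f ∘ e) = fun ξ => H ((-(2 * π)) • e ξ) := by
    ext ξ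
    rw [Real.fourier_eq', h, ← hmp.integral_comp e.measurableEmbedding]
    congr 1
    ext x
    rw [smul_eq_mul]
    congr 2
    simp [PiLp.inner_apply, e, Finset.mul_sum, Finset.sum_mul]
    exact Finset.sum_congr rfl fun b _ => by ring
  have hpi : -(2 * π) ≠ 0 := by simp [pi_ne_zero]
  have hFint : Integrable (FourierTransform.fourier (f ∘ e)) := by
    rw [hF]
    exact (hmp.integrable_comp_emb e.measurableEmbedding).mpr
      ((integrable_comp_smul_iff volume H hpi).mpr hH)
  have hcont : Continuous (f ∘ e) := hfc.comp (PiLp.continuous_ofLp 2 _)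
  have hinv := congrFun (hcont.fourierInv_fourier_eq
    ((hmp.integrable_comp_emb e.measurableEmbedding).mpr hf) hFint) (e.symm v)
  rw [Function.comp_apply, e.apply_symm_apply, Real.fourierInv_eq', hF] at hinv
  rw [← hinv]
  have hsmul := Measure.integral_comp_smul volume
    (fun y => H y * Complex.exp (-(Complex.I * ∑ b, (y b : ℂ) * v b))) (-(2 * π))
  rw [← hmp.integral_comp e.measurableEmbedding] at hsmul
  have habs : |((-(2 * π)) ^ Module.finrank ℝ (ι → ℝ))⁻¹| = ((2 * π) ^ Fintype.card ι)⁻¹ := by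
    rw [abs_inv, abs_pow, abs_neg, abs_of_pos two_pi_pos, Module.finrank_fintype_fun_eq_card]
  rw [habs, Complex.real_smul, Complex.ofReal_inv, Complex.ofReal_pow] at hsmul
  rw [← hsmul]
  congr 1
  ext ξ
  rw [smul_eq_mul, mul_comm]
  congr 2
  simp [PiLp.inner_apply, e, Finset.mul_sum, Finset.sum_mul]
  exact Finset.sum_congr rfl fun b _ => by ring

/-- Proposition 4.1 of the paper in coordinates: the inverse Fourier transform of the
`G`-equivariant central charge `∏ᵢ z^{aᵢ(y)} e^{-iθᵢ aᵢ(y)} Γ(aᵢ(y))` in the equivariant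
parameters equals the B-model central charge `g(v)`, the oscillatory integral of
`e^{-W/z}` over the fiber of the mirror Landau–Ginzburg model. -/
theorem stmt_0 (r k : ℕ) (hk : 1 ≤ k) (hkr : k ≤ r)
    (L : Matrix (Fin k) (Fin r) ℝ) (hL : L.rank = k)
    (Φ : ((Fin (r - k) → ℝ) × (Fin k → ℝ)) ≃ₗ[ℝ] (Fin r → ℝ))
    (hΦmp : MeasurePreserving (⇑Φ) volume volume)
    (hΦL : ∀ (w : Fin (r - k) → ℝ) (v : Fin k → ℝ), L.mulVec (Φ (w, v)) = v)
    (z : ℝ) (hz : 0 < z)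
    (θ : Fin r → ℝ) (hθ : ∀ i, θ i ∈ Set.Ioo (-(π / 2)) (π / 2))
    (γ : Fin k → ℝ) (hγ : ∀ i, 0 < L.transpose.mulVec γ i)
    (g : (Fin k → ℝ) → ℂ)
    (hg : ∀ v : Fin k → ℝ, g v = ∫ w : Fin (r - k) → ℝ,
      Complex.exp (-(1 / (z : ℂ)) *
        ∑ i, Complex.exp ((Φ (w, v) i : ℂ) + Complex.I * (θ i : ℂ))))
    (a : (Fin k → ℝ) → Fin r → ℂ)
    (ha : ∀ (y : Fin k → ℝ) (i : Fin r),
      a y i = ∑ b, ((γ b : ℂ) + Complex.I * (y b : ℂ)) * (L b i : ℂ)) :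
    ∀ v : Fin k → ℝ,
      Integrable (fun y : Fin k → ℝ =>
        (∏ i, Complex.exp (a y i * (Real.log z : ℂ)) *
            Complex.exp (-(Complex.I * (θ i : ℂ) * a y i)) * Complex.Gamma (a y i)) *
          Complex.exp (-(∑ b, ((γ b : ℂ) + Complex.I * (y b : ℂ)) * (v b : ℂ)))) ∧
      (((2 * π : ℝ) ^ k : ℂ))⁻¹ *
        (∫ y : Fin k → ℝ,
          (∏ i, Complex.exp (a y i * (Real.log z : ℂ)) *
              Complex.exp (-(Complex.I * (θ i : ℂ) * a y i)) * Complex.Gamma (a y i)) *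
            Complex.exp (-(∑ b, ((γ b : ℂ) + Complex.I * (y b : ℂ)) * (v b : ℂ)))) = g v := by
  have hp : 0 < 1 / z := one_div_pos.mpr hz
  have hre : ∀ y i, (a y i).re = L.transpose.mulVec γ i := by
    intro y i
    rw [ha]
    simp [Matrix.mulVec, dotProduct, mul_comm]
  have him : ∀ y i, (a y i).im = L.transpose.mulVecLin y i := by
    intro y i
    rw [ha, Matrix.mulVecLin_apply]
    simp [Matrix.mulVec, dotProduct, mul_comm]
  have hapos : ∀ y i, 0 < (a y i).re := fun y i => hre y i ▸ hγ i
  have hsurj : Function.Surjective L.mulVec := fun v => ⟨Φ (0, v), hΦL 0 v⟩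
  have hinj : Function.Injective L.transpose.mulVecLin := by
    rw [← LinearMap.ker_eq_bot, LinearMap.ker_eq_bot']
    intro y hy
    refine dotProduct_eq_zero _ fun v => ?_
    obtain ⟨x, rfl⟩ := hsurj v
    rw [Matrix.dotProduct_mulVec, ← Matrix.mulVec_transpose]
    rw [Matrix.mulVecLin_apply] at hy
    rw [hy, zero_dotProduct]
  have hΦc : Continuous Φ := Φ.toLinearMap.continuous_of_finiteDimensional
  have hΦe : MeasurableEmbedding Φ :=
    Φ.toContinuousLinearEquiv.toHomeomorph.measurableEmbedding
  set W : (Fin (r - k) → ℝ) → (Fin k → ℝ) → ℂ := fun w v => Complex.exp (-(1 / (z : ℂ)) *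
    ∑ i, Complex.exp ((Φ (w, v) i : ℂ) + Complex.I * (θ i : ℂ))) with hW
  -- Along the fiber over `v`, the product of kernels is the integrand of `g v` up to a factor.
  have hker : ∀ y w v, ∏ i, rotatedKernel (1 / z) (θ i) (a y i) (Φ (w, v) i) =
      Complex.exp (∑ b, ((γ b : ℂ) + Complex.I * (y b : ℂ)) * (v b : ℂ)) * W w v := by
    intro y w v
    have hv : ∑ i, a y i * (Φ (w, v) i : ℂ) =
        ∑ b, ((γ b : ℂ) + Complex.I * (y b : ℂ)) * (v b : ℂ) := by
      simp_rw [ha, Finset.sum_mul]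
      rw [Finset.sum_comm]
      refine Finset.sum_congr rfl fun b _ => ?_
      conv_rhs => rw [← hΦL w v]
      simp [Matrix.mulVec, dotProduct, Finset.mul_sum, mul_assoc]
    simp only [rotatedKernel, hW]
    rw [← Complex.exp_sum, Finset.sum_sub_distrib, hv, ← Finset.mul_sum, ← Complex.exp_add]
    simp [sub_eq_add_neg]
  set f : (Fin k → ℝ) → ℂ := fun v => Complex.exp (∑ b, (γ b : ℂ) * (v b : ℂ)) * g v with hf
  set H : (Fin k → ℝ) → ℂ := fun y => ∏ i, Complex.exp (a y i * (Real.log z : ℂ)) *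
    Complex.exp (-(Complex.I * (θ i : ℂ) * a y i)) * Complex.Gamma (a y i) with hH
  have hfactor : ∀ y i, ∫ x, rotatedKernel (1 / z) (θ i) (a y i) x =
      Complex.exp (a y i * (Real.log z : ℂ)) *
        Complex.exp (-(Complex.I * (θ i : ℂ) * a y i)) * Complex.Gamma (a y i) := by
    intro y i
    rw [integral_rotatedKernel hp (hθ i) (hapos y i)]
    congr 2
    rw [Complex.ofReal_div, Complex.ofReal_one, one_div_one_div,
      Complex.cpow_def_of_ne_zero (by exact_mod_cast hz.ne'), Complex.ofReal_log hz.le, mul_comm]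
  have hprod_int : ∀ y, Integrable fun q : (Fin (r - k) → ℝ) × (Fin k → ℝ) =>
      ∏ i, rotatedKernel (1 / z) (θ i) (a y i) (Φ q i) := fun y =>
    (hΦmp.integrable_comp_emb hΦe).mpr (Integrable.fintype_prod fun i =>
      integrable_rotatedKernel hp (hθ i) (hapos y i))
  have hinner : ∀ y v, ∫ w, ∏ i, rotatedKernel (1 / z) (θ i) (a y i) (Φ (w, v) i) =
      Complex.exp (∑ b, ((γ b : ℂ) + Complex.I * (y b : ℂ)) * (v b : ℂ)) * g v := by
    intro y v
    simp_rw [hker, integral_const_mul, hg v, hW]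
  have hf0 : ∀ v, f v = ∫ w, ∏ i, rotatedKernel (1 / z) (θ i) (a 0 i) (Φ (w, v) i) := by
    intro v
    rw [hinner]
    simp [hf]
  have hfint : Integrable f := by
    rw [funext hf0]
    exact (hprod_int 0).integral_prod_right
  have hfcont : Continuous f := by
    rw [funext hf0]
    choose C hC using fun i => exists_exp_sub_exp_le (hapos 0 i)
      (mul_pos hp (cos_pos_of_mem_Ioo (hθ i)))
    obtain ⟨c, hc, hcΦ⟩ := exists_prod_exp_neg_abs_le (T := Φ.toLinearMap) Φ.injective (hapos 0)
    have hC0 : ∀ i, 0 ≤ C i := fun i => by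
      have := (Real.exp_pos _).trans_le (hC i 0)
      simp only [abs_zero, mul_zero, neg_zero, Real.exp_zero, mul_one] at this
      exact this.le
    refine continuous_of_dominated (bound := fun w => (∏ i, C i) * rexp (-(c * ‖w‖)))
      (fun v => ?_) (fun v => .of_forall fun w => ?_)
      ((integrable_exp_neg_mul_norm hc).const_mul _) (.of_forall fun w => ?_)
    · exact Continuous.aestronglyMeasurable (by fun_prop)
    · rw [norm_prod]
      calc ∏ i, ‖rotatedKernel (1 / z) (θ i) (a 0 i) (Φ (w, v) i)‖
          ≤ ∏ i, C i * rexp (-((a 0 i).re * |Φ (w, v) i|)) := by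
            refine Finset.prod_le_prod (fun _ _ => norm_nonneg _) fun i _ => ?_
            rw [norm_rotatedKernel]
            exact hC i _
        _ = (∏ i, C i) * ∏ i, rexp (-((a 0 i).re * |Φ (w, v) i|)) := Finset.prod_mul_distrib
        _ ≤ (∏ i, C i) * rexp (-(c * ‖(w, v)‖)) :=
            mul_le_mul_of_nonneg_left (hcΦ (w, v)) (Finset.prod_nonneg fun i _ => hC0 i)
        _ ≤ (∏ i, C i) * rexp (-(c * ‖w‖)) := by
            have h1 : 0 ≤ ∏ i, C i := Finset.prod_nonneg fun i _ => hC0 i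
            have h2 : ‖w‖ ≤ ‖(w, v)‖ := norm_fst_le (w, v)
            gcongr
    · fun_prop
  have hHcont : Continuous H := by
    have hac : ∀ i, Continuous fun y => a y i := by
      intro i
      simp_rw [ha]
      fun_prop
    refine continuous_finsetProd _ fun i _ => Continuous.mul (by fun_prop) ?_
    refine continuous_iff_continuousAt.mpr fun y =>
      (Complex.differentiableAt_Gamma _ fun m hm => ?_).continuousAt.comp (hac i).continuousAt
    have h1 := hapos y i
    rw [hm] at h1
    simp only [Complex.neg_re, Complex.natCast_re] at h1
    linarith [(Nat.cast_nonneg m : (0 : ℝ) ≤ m)]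
  have hHint : Integrable H := by
    choose C δ hδ hC using fun i => exists_norm_exp_mul_Gamma_le (Real.log z) (hγ i) (hθ i)
    obtain ⟨c, hc, hcL⟩ := exists_prod_exp_neg_abs_le hinj hδ
    have hC0 : ∀ i, 0 ≤ C i := fun i => by
      have := (norm_nonneg _).trans (hC i (a 0 i) (hre 0 i))
      exact nonneg_of_mul_nonneg_left this (Real.exp_pos _)
    refine ((integrable_exp_neg_mul_norm hc).const_mul (∏ i, C i)).mono'
      hHcont.aestronglyMeasurable (.of_forall fun y => ?_)
    rw [hH, norm_prod]
    calc ∏ i, ‖_‖ ≤ ∏ i, C i * rexp (-(δ i * |L.transpose.mulVecLin y i|)) := by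
          refine Finset.prod_le_prod (fun _ _ => norm_nonneg _) fun i _ => ?_
          rw [← him]
          exact hC i _ (hre y i)
      _ = (∏ i, C i) * ∏ i, rexp (-(δ i * |L.transpose.mulVecLin y i|)) :=
          Finset.prod_mul_distrib
      _ ≤ (∏ i, C i) * rexp (-(c * ‖y‖)) :=
          mul_le_mul_of_nonneg_left (hcL y) (Finset.prod_nonneg fun i _ => hC0 i)
  have hfourier : ∀ y, H y = ∫ v, Complex.exp (Complex.I * ∑ b, (y b : ℂ) * v b) * f v := by
    intro y
    have h1 : H y = ∫ x : Fin r → ℝ, ∏ i, rotatedKernel (1 / z) (θ i) (a y i) (x i) := by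
      rw [integral_fintype_prod_volume_eq_prod
        (fun i x => rotatedKernel (1 / z) (θ i) (a y i) x)]
      simp_rw [hfactor, hH]
    rw [h1, ← hΦmp.integral_comp hΦe, Measure.volume_eq_prod, integral_prod_symm _ (hprod_int y)]
    congr 1
    ext v
    rw [hinner, hf, ← mul_assoc, ← Complex.exp_add, Finset.mul_sum, ← Finset.sum_add_distrib]
    congr 2
    exact Finset.sum_congr rfl fun b _ => by ring
  intro v
  have hsplit : ∀ y : Fin k → ℝ,
      H y * Complex.exp (-(∑ b, ((γ b : ℂ) + Complex.I * (y b : ℂ)) * (v b : ℂ))) =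
        Complex.exp (-∑ b, (γ b : ℂ) * (v b : ℂ)) *
          (H y * Complex.exp (-(Complex.I * ∑ b, (y b : ℂ) * v b))) := by
    intro y
    rw [mul_left_comm, ← Complex.exp_add, Finset.mul_sum, ← neg_add, ← Finset.sum_add_distrib]
    congr 3
    exact Finset.sum_congr rfl fun b _ => by ring
  have hinv := fourier_inversion_pi hfcont hfint hHint hfourier v
  rw [Fintype.card_fin] at hinv
  change Integrable (fun y => H y * _) ∧ _ * ∫ y, H y * _ = g v
  simp_rw [hsplit]
  constructor
  · refine (hHint.mul_bdd (c := 1) (Continuous.aestronglyMeasurable (by fun_prop))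
      (.of_forall fun y => ?_)).const_mul _
    rw [Complex.norm_exp]
    simp
  · rw [integral_const_mul, mul_left_comm, hinv, hf, ← mul_assoc, ← Complex.exp_add]
    simp
end

section
/- Let $r\ge k\ge 1$ be integers, let $L=(l^{(a)}_i)$ be a $k\times r$ real matrix of rank $k$, and fix a linear isomorphism $\Phi:\mathbb{R}^{r-k}\times\mathbb{R}^{k}\to\mathbb{R}^{r}$ with $|\det\Phi|=1$ and $L(\Phi(w,v))=v$ for all $(w,v)$. Fix a real $z>0$ and angles $\theta_1,\dots,\theta_r\in(-\pi/2,\pi/2)$, and assume there exists $\gamma\in\mathbb{R}^k$ with $(L^{T}\gamma)_i>0$ for every $i$. Then: (i) for every $v\in\mathbb{R}^k$ the integral $g(v)=\int_{\mathbb{R}^{r-k}}\exp\big(-\tfrac{1}{z}\sum_{i=1}^{r}e^{\Phi(w,v)_i+\sqrt{-1}\theta_i}\big)\,dw$ converges absolutely; (ii) for every $u\in\mathbb{C}^k$ with $\operatorname{Re}\,(L^{T}u)_i>0$ for all $i$, one has $\int_{\mathbb{R}^k}e^{\langle u,v\rangle}\,g(v)\,dv=\prod_{i=1}^{r}z^{(L^{T}u)_i}\,e^{-\sqrt{-1}\,\theta_i\,(L^{T}u)_i}\,\Gamma\big((L^{T}u)_i\big)$,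 the double integral being absolutely convergent. -/
open Real MeasureTheory

section GammaExp

variable {s c : ℂ}

/-- The Gamma integrand after the substitution `t = exp x`. -/
theorem exp_smul_cpow_mul_exp (s c : ℂ) (x : ℝ) :
    |Real.exp x| • (((Real.exp x : ℝ) : ℂ) ^ (s - 1) * Complex.exp (-(c * (Real.exp x : ℝ)))) =
      Complex.exp (s * x) * Complex.exp (-(c * Complex.exp x)) := by
  rw [abs_of_pos (Real.exp_pos x), Complex.real_smul, Complex.cpow_def_of_ne_zero
    (by exact_mod_cast (Real.exp_pos x).ne'), ← Complex.ofReal_log (Real.exp_pos x).le,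
    Real.log_exp, ← mul_assoc, Complex.ofReal_exp, ← Complex.exp_add]
  congr 2
  ring

theorem integrable_exp_mul_exp_neg_mul_exp (hs : 0 < s.re) (hc : 0 < c.re) :
    Integrable fun x : ℝ => Complex.exp (s * x) * Complex.exp (-(c * Complex.exp x)) := by
  have hGamma : IntegrableOn (fun t : ℝ => (t : ℂ) ^ (s - 1) * Complex.exp (-(c * t)))
      (Set.Ioi 0) := by
    have hscaled : IntegrableOn (fun t : ℝ => t ^ (s.re - 1) * Real.exp (-c.re * t))
        (Set.Ioi 0) := by
      simpa using integrableOn_rpow_mul_exp_neg_mul_rpow (p := 1) (s := s.re - 1) (b := c.re)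
        (by linarith) one_pos hc
    refine hscaled.mono' ?_ ?_
    · refine ContinuousOn.aestronglyMeasurable (fun t ht => ?_) measurableSet_Ioi
      refine ContinuousWithinAt.mul ?_ (by fun_prop)
      exact ((Complex.continuousAt_ofReal_cpow_const t _
        (Or.inr (ne_of_gt ht))).continuousWithinAt)
    · filter_upwards [ae_restrict_mem measurableSet_Ioi] with t ht
      rw [norm_mul, Complex.norm_cpow_eq_rpow_re_of_pos ht, Complex.norm_exp]
      simp
  rw [← Real.range_exp, ← Set.image_univ,
    integrableOn_image_iff_integrableOn_abs_deriv_smul MeasurableSet.univ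
      (fun x _ => (Real.hasDerivAt_exp x).hasDerivWithinAt) Real.exp_injective.injOn] at hGamma
  simpa only [exp_smul_cpow_mul_exp, integrableOn_univ] using hGamma

theorem integral_exp_mul_exp_neg_ofReal_mul_exp (hs : 0 < s.re) {b : ℝ} (hb : 0 < b) :
    ∫ x : ℝ, Complex.exp (s * x) * Complex.exp (-((b : ℂ) * Complex.exp x)) =
      (1 / (b : ℂ)) ^ s * Complex.Gamma s := by
  rw [← Complex.integral_cpow_mul_exp_neg_mul_Ioi hs hb, ← Real.range_exp, ← Set.image_univ,
    integral_image_eq_integral_abs_deriv_smul MeasurableSet.univ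
      (fun x _ => (Real.hasDerivAt_exp x).hasDerivWithinAt) Real.exp_injective.injOn]
  simp only [exp_smul_cpow_mul_exp, Measure.restrict_univ]

theorem differentiableOn_integral_exp_mul_exp_neg_mul_exp (hs : 0 < s.re) :
    DifferentiableOn ℂ
      (fun c : ℂ => ∫ x : ℝ, Complex.exp (s * x) * Complex.exp (-(c * Complex.exp x)))
      {c | 0 < c.re} := by
  intro c₀ (hc₀ : 0 < c₀.re)
  have hbound : Integrable fun x : ℝ =>
      ‖Complex.exp ((s + 1) * x) * Complex.exp (-(((c₀.re / 2 : ℝ) : ℂ) * Complex.exp x))‖ :=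
    (integrable_exp_mul_exp_neg_mul_exp (by simp; linarith)
      (by rw [Complex.ofReal_re]; linarith)).norm
  have hnhds : {c : ℂ | c₀.re / 2 < c.re} ∈ nhds c₀ :=
    (isOpen_lt continuous_const Complex.continuous_re).mem_nhds (half_lt_self hc₀)
  refine (hasDerivAt_integral_of_dominated_loc_of_deriv_le
    (F' := fun (c : ℂ) (x : ℝ) => -(Complex.exp ((s + 1) * x) * Complex.exp (-(c * Complex.exp x))))
    hnhds (.of_forall fun c => Continuous.aestronglyMeasurable (by fun_prop))
    (integrable_exp_mul_exp_neg_mul_exp hs hc₀)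
    (Continuous.aestronglyMeasurable (by fun_prop)) (.of_forall fun x c hc => ?_) hbound
    (.of_forall fun x c _ => ?_)).2.differentiableAt.differentiableWithinAt
  · rw [norm_neg, norm_mul, norm_mul]
    refine mul_le_mul_of_nonneg_left ?_ (norm_nonneg _)
    rw [Complex.norm_exp, Complex.norm_exp, Real.exp_le_exp]
    simp only [← Complex.ofReal_exp, Complex.neg_re, Complex.re_mul_ofReal, Complex.ofReal_re]
    exact neg_le_neg (mul_le_mul_of_nonneg_right (le_of_lt hc) (Real.exp_pos x).le)
  · have hderiv := ((((hasDerivAt_id c).mul_const (Complex.exp x)).neg).cexp).const_mul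
      (Complex.exp (s * x))
    refine hderiv.congr_deriv ?_
    rw [add_mul, one_mul, Complex.exp_add]
    simp only [Pi.neg_apply, id]
    ring_nf

/-- The rotated Gamma integral, on the line: the case of real `c` extends to the right
half-plane by analytic continuation. -/
theorem integral_exp_mul_exp_neg_mul_exp (hs : 0 < s.re) (hc : 0 < c.re) :
    ∫ x : ℝ, Complex.exp (s * x) * Complex.exp (-(c * Complex.exp x)) =
      (1 / c) ^ s * Complex.Gamma s := by
  have hopen : IsOpen {c : ℂ | 0 < c.re} := isOpen_lt continuous_const Complex.continuous_re
  have hpow : DifferentiableOn ℂ (fun c : ℂ => (1 / c) ^ s * Complex.Gamma s)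
      {c | 0 < c.re} := by
    intro c (hc : 0 < c.re)
    have hne : c ≠ 0 := fun h => by simp [h] at hc
    have hinv : 1 / c ∈ Complex.slitPlane := by
      refine Or.inl ?_
      rw [one_div, Complex.inv_re]
      exact div_pos hc (Complex.normSq_pos.2 hne)
    exact (((differentiableAt_const _).div differentiableAt_id hne).cpow_const
      hinv |>.mul_const _).differentiableWithinAt
  have hreal : Filter.Tendsto (fun b : ℝ => (b : ℂ)) (nhdsWithin 1 {1}ᶜ)
      (nhdsWithin (1 : ℂ) {1}ᶜ) :=
    tendsto_nhdsWithin_of_tendsto_nhds_of_eventually_within _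
      (Complex.continuous_ofReal.tendsto' 1 1 Complex.ofReal_one |>.mono_left nhdsWithin_le_nhds)
      (eventually_mem_nhdsWithin.mono fun b hb => by simpa using hb)
  have hpos : ∀ᶠ b : ℝ in nhdsWithin 1 {1}ᶜ, 0 < b :=
    nhdsWithin_le_nhds (lt_mem_nhds one_pos)
  exact ((differentiableOn_integral_exp_mul_exp_neg_mul_exp hs).analyticOnNhd hopen
    ).eqOn_of_preconnected_of_frequently_eq (hpow.analyticOnNhd hopen)
    (convex_halfSpace_re_gt 0).isPreconnected (z₀ := 1) (by simp)
    (hreal.frequently (hpos.mono fun b hb =>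
      integral_exp_mul_exp_neg_ofReal_mul_exp hs hb).frequently) hc

end GammaExp

section Fibration

variable {ι κ ν : Type*} [Fintype ι] [Fintype κ]
  {L : Matrix κ ι ℝ} {Φ : ((ν → ℝ) × (κ → ℝ)) ≃ₗ[ℝ] (ι → ℝ)}

theorem exp_pairing_mul_exp_eq_prod
    (hΦL : ∀ (w : ν → ℝ) (v : κ → ℝ), L.mulVec (Φ (w, v)) = v)
    (c : ι → ℂ) (u : κ → ℂ) (p : (κ → ℝ) × (ν → ℝ)) :
    Complex.exp (∑ a, u a * (p.1 a : ℂ)) *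
        Complex.exp (-∑ i, c i * Complex.exp (Φ (p.2, p.1) i)) =
      ∏ i, Complex.exp ((∑ a, u a * (L a i : ℂ)) * (Φ p.swap i : ℂ)) *
        Complex.exp (-(c i * Complex.exp (Φ p.swap i))) := by
  have hpair : ∑ a, u a * (p.1 a : ℂ) =
      ∑ i, (∑ a, u a * (L a i : ℂ)) * (Φ p.swap i : ℂ) := by
    conv_lhs => rw [← hΦL p.2 p.1]
    simp only [Matrix.mulVec, dotProduct, Complex.ofReal_sum, Complex.ofReal_mul,
      Finset.mul_sum, Finset.sum_mul]
    rw [Finset.sum_comm]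
    exact Finset.sum_congr rfl fun i _ => Finset.sum_congr rfl fun a _ => (mul_assoc _ _ _).symm
  rw [Finset.prod_mul_distrib, ← Complex.exp_sum, ← Complex.exp_sum, hpair,
    Finset.sum_neg_distrib]
  rfl

variable [Fintype ν]

theorem measurePreserving_comp_swap (hΦmp : MeasurePreserving (⇑Φ) volume volume) :
    MeasurePreserving (fun p : (κ → ℝ) × (ν → ℝ) => Φ p.swap) volume volume :=
  hΦmp.comp Measure.measurePreserving_swap

theorem measurableEmbedding_comp_swap :
    MeasurableEmbedding (fun p : (κ → ℝ) × (ν → ℝ) => Φ p.swap) :=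
  Φ.toContinuousLinearEquiv.toHomeomorph.measurableEmbedding.comp
    MeasurableEquiv.prodComm.measurableEmbedding

theorem integrable_exp_pairing_mul_exp
    (hΦmp : MeasurePreserving (⇑Φ) volume volume)
    (hΦL : ∀ (w : ν → ℝ) (v : κ → ℝ), L.mulVec (Φ (w, v)) = v)
    {c : ι → ℂ} (hc : ∀ i, 0 < (c i).re)
    {u : κ → ℂ} (hu : ∀ i, 0 < (∑ a, u a * (L a i : ℂ)).re) :
    Integrable fun p : (κ → ℝ) × (ν → ℝ) => Complex.exp (∑ a, u a * (p.1 a : ℂ)) *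
        Complex.exp (-∑ i, c i * Complex.exp (Φ (p.2, p.1) i)) := by
  simp only [exp_pairing_mul_exp_eq_prod hΦL]
  exact (measurePreserving_comp_swap hΦmp).integrable_comp_of_integrable
    (Integrable.fintype_prod fun i => integrable_exp_mul_exp_neg_mul_exp (hu i) (hc i))

theorem integral_exp_pairing_mul_exp
    (hΦmp : MeasurePreserving (⇑Φ) volume volume)
    (hΦL : ∀ (w : ν → ℝ) (v : κ → ℝ), L.mulVec (Φ (w, v)) = v)
    {c : ι → ℂ} (hc : ∀ i, 0 < (c i).re)
    {u : κ → ℂ} (hu : ∀ i, 0 < (∑ a, u a * (L a i : ℂ)).re) :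
    ∫ v : κ → ℝ, Complex.exp (∑ a, u a * (v a : ℂ)) *
        ∫ w : ν → ℝ, Complex.exp (-∑ i, c i * Complex.exp (Φ (w, v) i)) =
      ∏ i, (1 / c i) ^ (∑ a, u a * (L a i : ℂ)) * Complex.Gamma (∑ a, u a * (L a i : ℂ)) := by
  simp only [← integral_const_mul]
  refine (integral_prod _ (integrable_exp_pairing_mul_exp hΦmp hΦL hc hu)).symm.trans ?_
  simp only [exp_pairing_mul_exp_eq_prod hΦL]
  refine ((measurePreserving_comp_swap hΦmp).integral_comp measurableEmbedding_comp_swap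
    (fun x : ι → ℝ => ∏ i, Complex.exp ((∑ a, u a * (L a i : ℂ)) * (x i : ℂ)) *
        Complex.exp (-(c i * Complex.exp (x i))))).trans ?_
  rw [integral_fintype_prod_volume_eq_prod (fun i (x : ℝ) =>
    Complex.exp ((∑ a, u a * (L a i : ℂ)) * (x : ℂ)) * Complex.exp (-(c i * Complex.exp x)))]
  exact Finset.prod_congr rfl fun i _ => integral_exp_mul_exp_neg_mul_exp (hu i) (hc i)

/-- Fubini gives integrability along almost every fibre; comparing with a nearby good fibre,
at the cost of shrinking the coefficients by a factor `e`, gives it along every fibre. -/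
theorem integrable_exp_fiber
    (hΦmp : MeasurePreserving (⇑Φ) volume volume)
    (hΦL : ∀ (w : ν → ℝ) (v : κ → ℝ), L.mulVec (Φ (w, v)) = v)
    (hγ : ∃ γ : κ → ℝ, ∀ i, 0 < L.transpose.mulVec γ i)
    {c : ι → ℂ} (hc : ∀ i, 0 < (c i).re) (v : κ → ℝ) :
    Integrable fun w : ν → ℝ => Complex.exp (-∑ i, c i * Complex.exp (Φ (w, v) i)) := by
  obtain ⟨γ, hγ⟩ := hγ
  have hΦ : Continuous Φ := Φ.toContinuousLinearEquiv.continuous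
  set ρ : ι → ℝ := fun i => (c i).re * Real.exp (-1) with hρ
  have hint := integrable_exp_pairing_mul_exp hΦmp hΦL (c := fun i => (ρ i : ℂ))
    (fun i => by
      rw [Complex.ofReal_re]
      exact mul_pos (hc i) (Real.exp_pos (-1))) (u := fun a => (γ a : ℂ))
    (fun i => by
      have := hγ i
      simp only [Matrix.mulVec, dotProduct, Matrix.transpose_apply] at this
      simpa [mul_comm] using this)
  have hdense := Measure.dense_of_ae hint.prod_right_ae
  have hopen : IsOpen {v' : κ → ℝ | ∀ i, -1 < Φ (0, v - v') i} := by
    simp only [Set.ofPred_forall]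
    exact isOpen_iInter_of_finite fun i => isOpen_lt continuous_const
      ((continuous_apply i).comp (hΦ.comp (by fun_prop)))
  obtain ⟨v', hv', hv'int⟩ := hdense.inter_open_nonempty _ hopen ⟨v, fun i => by
    rw [sub_self, ← Prod.zero_eq_mk, map_zero]
    simp⟩
  have hfiber := (integrable_const_mul_iff
    (Complex.exp_ne_zero (∑ a, (γ a : ℂ) * (v' a : ℂ))).isUnit _).1 hv'int
  refine hfiber.mono (Continuous.aestronglyMeasurable (by fun_prop)) (.of_forall fun w => ?_)
  have hsplit : Φ (w, v) = Φ (w, v') + Φ (0, v - v') := by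
    rw [← map_add]
    simp
  rw [Complex.norm_exp, Complex.norm_exp, Real.exp_le_exp]
  simp only [← Complex.ofReal_exp, Complex.neg_re, Complex.re_sum, Complex.re_mul_ofReal,
    Complex.ofReal_re]
  refine neg_le_neg (Finset.sum_le_sum fun i _ => ?_)
  rw [hρ, mul_assoc, ← Real.exp_add, hsplit, Pi.add_apply]
  have := hv' i
  exact mul_le_mul_of_nonneg_left (Real.exp_le_exp.2 (by linarith)) (hc i).le

end Fibration

/-- The Fubini step in Section 4 of the paper: the fiberwise B-model central charge
`g(v)` is absolutely convergent, and its Fourier transform in `v` recovers the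
`G`-equivariant central charge `∏ᵢ z^{(Lᵀu)ᵢ} e^{-iθᵢ (Lᵀu)ᵢ} Γ((Lᵀu)ᵢ)`, the double
integral being absolutely convergent. -/
theorem stmt_8 (r k : ℕ) (hk : 1 ≤ k) (hkr : k ≤ r)
    (L : Matrix (Fin k) (Fin r) ℝ) (hL : L.rank = k)
    (Φ : ((Fin (r - k) → ℝ) × (Fin k → ℝ)) ≃ₗ[ℝ] (Fin r → ℝ))
    (hΦmp : MeasurePreserving (⇑Φ) volume volume)
    (hΦL : ∀ (w : Fin (r - k) → ℝ) (v : Fin k → ℝ), L.mulVec (Φ (w, v)) = v)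
    (z : ℝ) (hz : 0 < z)
    (θ : Fin r → ℝ) (hθ : ∀ i, θ i ∈ Set.Ioo (-(π / 2)) (π / 2))
    (hγ : ∃ γ : Fin k → ℝ, ∀ i, 0 < L.transpose.mulVec γ i)
    (g : (Fin k → ℝ) → ℂ)
    (hg : ∀ v : Fin k → ℝ, g v = ∫ w : Fin (r - k) → ℝ,
      Complex.exp (-(1 / (z : ℂ)) *
        ∑ i, Complex.exp ((Φ (w, v) i : ℂ) + Complex.I * (θ i : ℂ)))) :
    (∀ v : Fin k → ℝ,
      Integrable (fun w : Fin (r - k) → ℝ =>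
        Complex.exp (-(1 / (z : ℂ)) *
          ∑ i, Complex.exp ((Φ (w, v) i : ℂ) + Complex.I * (θ i : ℂ))))) ∧
    (∀ u : Fin k → ℂ, (∀ i, 0 < (∑ a, u a * (L a i : ℂ)).re) →
      Integrable (fun p : (Fin k → ℝ) × (Fin (r - k) → ℝ) =>
        Complex.exp (∑ a, u a * (p.1 a : ℂ)) *
          Complex.exp (-(1 / (z : ℂ)) *
            ∑ i, Complex.exp ((Φ (p.2, p.1) i : ℂ) + Complex.I * (θ i : ℂ)))) ∧
      (∫ v : Fin k → ℝ, Complex.exp (∑ a, u a * (v a : ℂ)) * g v) =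
        ∏ i, Complex.exp ((∑ a, u a * (L a i : ℂ)) * (Real.log z : ℂ)) *
          Complex.exp (-(Complex.I * (θ i : ℂ) * ∑ a, u a * (L a i : ℂ))) *
          Complex.Gamma (∑ a, u a * (L a i : ℂ))) := by
  set c : Fin r → ℂ := fun i => Complex.exp (-((Real.log z : ℂ) - Complex.I * θ i)) with hcdef
  have hzexp : Complex.exp (Real.log z : ℂ) = z := by
    rw [← Complex.ofReal_exp, Real.exp_log hz]
  have hc : ∀ i, 0 < (c i).re := fun i => by
    rw [hcdef, Complex.exp_re]
    refine mul_pos (Real.exp_pos _) (Real.cos_pos_of_mem_Ioo ?_)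
    simpa using hθ i
  have hexp : ∀ x : Fin r → ℝ, -(1 / (z : ℂ)) *
      ∑ i, Complex.exp ((x i : ℂ) + Complex.I * (θ i : ℂ)) =
      -∑ i, c i * Complex.exp (x i) := fun x => by
    rw [neg_mul, Finset.mul_sum]
    congr 1
    refine Finset.sum_congr rfl fun i _ => ?_
    rw [← hzexp, one_div, ← Complex.exp_neg, ← Complex.exp_add, ← Complex.exp_add]
    congr 1
    ring
  have hpow : ∀ i (s : ℂ), (1 / c i) ^ s =
      Complex.exp (s * (Real.log z : ℂ)) * Complex.exp (-(Complex.I * (θ i : ℂ) * s)) :=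
    fun i s => by
      have hlog : Complex.log (1 / c i) = (Real.log z : ℂ) - Complex.I * θ i := by
        rw [hcdef, one_div, ← Complex.exp_neg, neg_neg]
        have := hθ i
        refine Complex.log_exp ?_ ?_ <;> simp <;> linarith [this.1, this.2, Real.pi_pos]
      rw [Complex.cpow_def_of_ne_zero (one_div_ne_zero (Complex.exp_ne_zero _)), hlog,
        ← Complex.exp_add]
      congr 1
      ring
  simp only [hexp] at hg ⊢
  refine ⟨integrable_exp_fiber hΦmp hΦL hγ hc, fun u hu =>
    ⟨integrable_exp_pairing_mul_exp hΦmp hΦL hc hu, ?_⟩⟩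
  simp only [hg, ← hpow]
  exact integral_exp_pairing_mul_exp hΦmp hΦL hc hu
end
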